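/- Let G and H be groups with symmetric generating sets X and Y respectively, and Λ and Γ disjoint finite alphabets. If (G,X,Λ) is S_k-graph automatic and (H,Y,Γ) is S_l-graph automatic, then the free product G∗H is S_{max(k,l)}-graph automatic with respect to the generating set X∪Y and the alphabet {#}∪Λ∪Γ (where # is a new symbol). -/

import Mathlib

/-- A transition of a `k`-counter automaton with state set `Q` over alphabet `α`.
It reads `input` (`none` meaning an ε-transition), and for each counter it may be
guarded (`guard i = some true`: counter `i` must be zero; `guard i = some false`:
counter `i` must be nonzero; `guard i = none`: no test), it adds `add i` to counter `i`,
and if `reset i = true` it sets counter `i` to zero. -/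
structure CTrans (α Q : Type) (k : ℕ) where
  src : Q
  tgt : Q
  input : Option α
  add : Fin k → ℤ
  guard : Fin k → Option Bool
  reset : Fin k → Bool

/-- A nondeterministic `k`-counter automaton over the alphabet `α`: a finite state set
with an initial state, accept states, and finitely many transitions. -/
structure CAuto (α : Type) (k : ℕ) where
  Q : Type
  [fintypeQ : Fintype Q]
  start : Q
  accept : Q → Bool
  trans : List (CTrans α Q k)

namespace CAuto

variable {α : Type} {k : ℕ}

/-- The guard of a transition is satisfied by the counter values `c`. -/
def GuardOK {Q : Type} (t : CTrans α Q k) (c : Fin k → ℤ) : Prop :=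
  ∀ i, (t.guard i = some true → c i = 0) ∧ (t.guard i = some false → c i ≠ 0)

/-- The effect of a transition on the counter values. -/
def applyC {Q : Type} (t : CTrans α Q k) (c : Fin k → ℤ) : Fin k → ℤ :=
  fun i => if t.reset i then 0 else c i + t.add i

/-- `M.Valid c ts c'` : the list of transitions `ts` is a valid computation path
of `M` from the configuration `c` to the configuration `c'`. -/
def Valid (M : CAuto α k) : M.Q × (Fin k → ℤ) → List (CTrans α M.Q k) → M.Q × (Fin k → ℤ) → Prop
  | c, [], c' => c = c'
  | c, t :: ts, c' =>
      t ∈ M.trans ∧ t.src = c.1 ∧ GuardOK t c.2 ∧ M.Valid (t.tgt, applyC t c.2) ts c'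

/-- The word read along a computation path (ε-transitions read nothing). -/
def word {Q : Type} (ts : List (CTrans α Q k)) : List α := ts.filterMap (·.input)

/-- The initial configuration: the start state with all counters zero. -/
def startConfig (M : CAuto α k) : M.Q × (Fin k → ℤ) := (M.start, fun _ => 0)

/-- `M` accepts `w` if some computation path reading `w` leads from the initial
configuration to an accept state with all counters equal to `0`. -/
def Accepts (M : CAuto α k) (w : List α) : Prop :=
  ∃ ts q, M.Valid M.startConfig ts (q, fun _ => 0) ∧ M.accept q = true ∧ word ts = w

/-- The language accepted by `M`. -/
def lang (M : CAuto α k) : Language α := { w | M.Accepts w }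

/-- A blind automaton has no guards and no resets. -/
def Blind (M : CAuto α k) : Prop :=
  ∀ t ∈ M.trans, (∀ i, t.guard i = none) ∧ (∀ i, t.reset i = false)

/-- `M` runs in quasi-realtime: there is a uniform bound on the number of consecutive
ε-transitions along any computation path. -/
def QuasiRealtime (M : CAuto α k) : Prop :=
  ∃ B : ℕ, ∀ ts c, M.Valid M.startConfig ts c →
    ∀ l₁ l₂ l₃, ts = l₁ ++ l₂ ++ l₃ → (∀ t ∈ l₂, t.input = none) → l₂.length ≤ B

/-- `M` is deterministic: it has no ε-transitions and from each configuration at most one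
transition applies to each input letter. -/
def Deterministic (M : CAuto α k) : Prop :=
  (∀ t ∈ M.trans, t.input ≠ none) ∧
    ∀ t₁ ∈ M.trans, ∀ t₂ ∈ M.trans, t₁.src = t₂.src → t₁.input = t₂.input →
      ∀ c : Fin k → ℤ, GuardOK t₁ c → GuardOK t₂ c → t₁ = t₂

end CAuto

/-- The convolution of two words `u ∈ A*`, `v ∈ B*`: the word of length
`max |u| |v|` over `Option A × Option B` (with `none` playing the role of the
padding symbol ⋄) whose `i`-th letter is the pair of the `i`-th letters of `u`
and `v`, padded with `none`. -/
def conv {A B : Type} (u : List A) (v : List B) : List (Option A × Option B) :=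
  (List.range (max u.length v.length)).map fun i => (u[i]?, v[i]?)

/-- The multiplier language `L_x` of a normal form `nf : L → G` for the
group element `x`: all convolutions `⊗(u,v)` with `u, v ∈ L` and `ū x = v̄`. -/
def Mult {Λ G : Type} [Group G] (nf : List Λ → G) (L : Language Λ) (x : G) :
    Language (Option Λ × Option Λ) :=
  { w | ∃ u ∈ L, ∃ v ∈ L, nf u * x = nf v ∧ w = conv u v }

/-- The word length (geodesic length) `‖g‖_X` of `g` with respect to a generating set
`X ⊆ G`: the minimal length of a word over `X` whose product is `g`. -/
noncomputable def wordLength {G : Type} [Group G] (X : Set G) (g : G) : ℕ :=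
  sInf { n | ∃ w : List G, (∀ a ∈ w, a ∈ X) ∧ w.length = n ∧ w.prod = g }

/-- A language is regular if it is accepted by a deterministic finite automaton
with finitely many states. -/
def IsRegLang {α : Type} (L : Language α) : Prop :=
  ∃ (σ : Type) (_ : Fintype σ) (M : DFA α σ), M.accepts = L

/-- A class of formal languages: an assignment of a set of languages to each alphabet. -/
def LangClass : Type 1 := (α : Type) → Set (Language α)

/-- The image of a language under the monoid homomorphism `α* → β*` induced by
`f : α → List β`. -/
def homImage {α β : Type} (f : α → List β) (L : Language α) : Language β :=
  { w | ∃ u ∈ L, w = (u.map f).flatten }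

/-- The preimage of a language under the monoid homomorphism `α* → β*` induced by
`f : α → List β`. -/
def homPreimage {α β : Type} (f : α → List β) (L : Language β) : Language α :=
  { u | (u.map f).flatten ∈ L }

/-- `C` is closed under homomorphism. -/
def ClosedUnderHom (C : LangClass) : Prop :=
  ∀ (α β : Type) [Fintype α] [Fintype β], ∀ L ∈ C α, ∀ f : α → List β, homImage f L ∈ C β

/-- `C` is closed under ε-free homomorphism. -/
def ClosedUnderEpsFreeHom (C : LangClass) : Prop :=
  ∀ (α β : Type) [Fintype α] [Fintype β], ∀ L ∈ C α, ∀ f : α → List β,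
    (∀ a, f a ≠ []) → homImage f L ∈ C β

/-- `C` is closed under inverse homomorphism. -/
def ClosedUnderInvHom (C : LangClass) : Prop :=
  ∀ (α β : Type) [Fintype α] [Fintype β], ∀ L ∈ C β, ∀ f : α → List β, homPreimage f L ∈ C α

/-- `C` is closed under (finite) intersection. -/
def ClosedUnderInter (C : LangClass) : Prop :=
  ∀ (α : Type) [Fintype α], ∀ L₁ ∈ C α, ∀ L₂ ∈ C α, L₁ ⊓ L₂ ∈ C α

/-- `C` is closed under intersection with regular languages. -/
def ClosedUnderInterReg (C : LangClass) : Prop :=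
  ∀ (α : Type) [Fintype α], ∀ L ∈ C α, ∀ R : Language α, IsRegLang R → L ⊓ R ∈ C α

/-- `C` contains all regular languages. -/
def ContainsRegular (C : LangClass) : Prop :=
  ∀ (α : Type) [Fintype α], ∀ L : Language α, IsRegLang L → L ∈ C α

/-- `(G,X,Λ)` is `C`-graph automatic via the normal form `L ⊆ Λ*` with bijection
`nf : L → G`: `L ∈ C`, `nf` restricted to `L` is a bijection onto `G`, and every
multiplier language `L_x`, `x ∈ X`, is in `C`. -/
def CGraphAutoWith (C : LangClass) {G : Type} [Group G] (X : Set G) {Λ : Type} [Fintype Λ]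
    (L : Language Λ) (nf : List Λ → G) : Prop :=
  Set.BijOn nf L Set.univ ∧ L ∈ C Λ ∧ ∀ x ∈ X, Mult nf L x ∈ C (Option Λ × Option Λ)

/-- `S_k`: the class of languages accepted by quasi-realtime nondeterministic non-blind
`k`-counter automata. -/
def Sclass (k : ℕ) (α : Type) : Set (Language α) :=
  { L | ∃ M : CAuto α k, M.QuasiRealtime ∧ M.lang = L }

/-- `(G,X,Λ)` is `S_k`-graph automatic: there is a normal form `L ⊆ Λ*` in `S_k`, in
bijection with `G`, all of whose multiplier languages `L_x`, `x ∈ X`, are in `S_k`. -/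
def SGraphAutomatic (k : ℕ) {G : Type} [Group G] (X : Set G) (Λ : Type) : Prop :=
  ∃ (L : Language Λ) (nf : List Λ → G), Set.BijOn nf L Set.univ ∧ L ∈ Sclass k Λ ∧
    ∀ x ∈ X, Mult nf L x ∈ Sclass k (Option Λ × Option Λ)

namespace CAuto

variable {α β : Type} {k m : ℕ}

/-- `M.Step c a c'`: some transition of `M` with input `a` leads from `c` to `c'`. -/
def Step (M : CAuto α k) (c : M.Q × (Fin k → ℤ)) (a : Option α) (c' : M.Q × (Fin k → ℤ)) : Prop :=
  ∃ t ∈ M.trans, t.src = c.1 ∧ t.input = a ∧ GuardOK t c.2 ∧ c' = (t.tgt, applyC t c.2)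

/-- `M.Run c w c'`: some computation path of `M` reading `w` leads from `c` to `c'`. -/
inductive Run (M : CAuto α k) :
    M.Q × (Fin k → ℤ) → List α → M.Q × (Fin k → ℤ) → Prop
  | nil (c) : Run M c [] c
  | eps {c c' c'' w} : M.Step c none c' → Run M c' w c'' → Run M c w c''
  | read {c c' d a w} : M.Step c (some a) c' → Run M c' w d → Run M c (a :: w) d

/-- `M.EpsRun n c c'`: some path of `n` consecutive ε-transitions leads from `c` to `c'`. -/
inductive EpsRun (M : CAuto α k) : ℕ → M.Q × (Fin k → ℤ) → M.Q × (Fin k → ℤ) → Prop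
  | nil (c) : EpsRun M 0 c c
  | cons {n c c' c''} : M.Step c none c' → EpsRun M n c' c'' → EpsRun M (n + 1) c c''

theorem Run.append {M : CAuto α k} {c c' c'' : M.Q × (Fin k → ℤ)} {w w' : List α}
    (h : M.Run c w c') (h' : M.Run c' w' c'') : M.Run c (w ++ w') c'' := by
  induction h with
  | nil => exact h'
  | eps s _ ih => exact .eps s (ih h')
  | read s _ ih => exact .read s (ih h')

theorem valid_append {M : CAuto α k} {c c' : M.Q × (Fin k → ℤ)} {l₁ l₂ : List (CTrans α M.Q k)} :
    M.Valid c (l₁ ++ l₂) c' ↔ ∃ d, M.Valid c l₁ d ∧ M.Valid d l₂ c' := by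
  induction l₁ generalizing c with
  | nil => simp [Valid]
  | cons t l ih => simp [Valid, ih]; tauto

theorem run_iff_valid {M : CAuto α k} {c c' : M.Q × (Fin k → ℤ)} {w : List α} :
    M.Run c w c' ↔ ∃ ts, M.Valid c ts c' ∧ word ts = w := by
  constructor
  · intro h
    induction h with
    | nil c => exact ⟨[], rfl, rfl⟩
    | eps s _ ih =>
      obtain ⟨t, ht, hs, hi, hg, rfl⟩ := s
      obtain ⟨ts, hv, hw⟩ := ih
      exact ⟨t :: ts, ⟨ht, hs, hg, hv⟩, by simp [word, hi] at hw ⊢; exact hw⟩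
    | read s _ ih =>
      obtain ⟨t, ht, hs, hi, hg, rfl⟩ := s
      obtain ⟨ts, hv, hw⟩ := ih
      exact ⟨t :: ts, ⟨ht, hs, hg, hv⟩, by simp [word, hi] at hw ⊢; exact hw⟩
  · rintro ⟨ts, hv, rfl⟩
    induction ts generalizing c with
    | nil => obtain rfl : c = c' := hv; exact .nil c
    | cons t ts ih =>
      obtain ⟨ht, hs, hg, hv⟩ := hv
      cases hi : t.input with
      | none =>
        have := Run.eps ⟨t, ht, hs, hi, hg, rfl⟩ (ih hv)
        simpa [word, hi] using this
      | some a =>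
        have := Run.read ⟨t, ht, hs, hi, hg, rfl⟩ (ih hv)
        simpa [word, hi] using this

theorem epsRun_iff_valid {M : CAuto α k} {c c' : M.Q × (Fin k → ℤ)} {n : ℕ} :
    M.EpsRun n c c' ↔ ∃ ts, M.Valid c ts c' ∧ (∀ t ∈ ts, t.input = none) ∧ ts.length = n := by
  constructor
  · intro h
    induction h with
    | nil c => exact ⟨[], rfl, by simp, rfl⟩
    | cons s _ ih =>
      obtain ⟨t, ht, hs, hi, hg, rfl⟩ := s
      obtain ⟨ts, hv, hw, rfl⟩ := ih
      exact ⟨t :: ts, ⟨ht, hs, hg, hv⟩, by simpa [hi] using hw, rfl⟩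
  · rintro ⟨ts, hv, hn, rfl⟩
    induction ts generalizing c with
    | nil => obtain rfl : c = c' := hv; exact .nil c
    | cons t ts ih =>
      obtain ⟨ht, hs, hg, hv⟩ := hv
      exact .cons ⟨t, ht, hs, hn t (by simp), hg, rfl⟩ (ih hv fun t ht => hn t (by simp [ht]))

theorem mem_lang_iff {M : CAuto α k} {w : List α} :
    w ∈ M.lang ↔ ∃ q, M.Run M.startConfig w (q, fun _ => 0) ∧ M.accept q = true := by
  change (∃ ts q, _ ∧ _ ∧ _) ↔ _
  simp only [run_iff_valid]
  constructor
  · rintro ⟨ts, q, h, ha, hw⟩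
    exact ⟨q, ⟨ts, h, hw⟩, ha⟩
  · rintro ⟨q, ⟨ts, h, hw⟩, ha⟩
    exact ⟨ts, q, h, ha, hw⟩

theorem quasiRealtime_iff {M : CAuto α k} :
    M.QuasiRealtime ↔ ∃ B, ∀ w c, M.Run M.startConfig w c → ∀ n c', M.EpsRun n c c' → n ≤ B := by
  simp only [run_iff_valid, epsRun_iff_valid]
  constructor
  · rintro ⟨B, h⟩
    refine ⟨B, ?_⟩
    rintro w c ⟨ts, hv, -⟩ n c' ⟨ts', hv', hn, rfl⟩
    exact h (ts ++ ts') c' (valid_append.2 ⟨c, hv, hv'⟩) ts ts' [] (by simp) hn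
  · rintro ⟨B, h⟩
    refine ⟨B, ?_⟩
    rintro ts c hv l₁ l₂ l₃ rfl hn
    obtain ⟨d, hv, -⟩ := valid_append.1 hv
    obtain ⟨e, hv, hv'⟩ := valid_append.1 hv
    exact h _ e ⟨l₁, hv, rfl⟩ _ d ⟨l₂, hv', hn, rfl⟩

/-- Quasi-realtime is inherited by an automaton simulated step by step. -/
theorem QuasiRealtime.of_simulation {M : CAuto α k} {N : CAuto β m} (hM : M.QuasiRealtime)
    (R : M.Q × (Fin k → ℤ) → N.Q × (Fin m → ℤ) → Prop)
    (h0 : R M.startConfig N.startConfig)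
    (hR : ∀ c d a d', R c d → N.Step d a d' →
      ∃ b c', M.Step c b c' ∧ R c' d' ∧ (a = none → b = none)) :
    N.QuasiRealtime := by
  obtain ⟨B, hB⟩ := quasiRealtime_iff.1 hM
  refine quasiRealtime_iff.2 ⟨B, fun w d hd n d' he => ?_⟩
  have hrun : ∀ d₀ w d, N.Run d₀ w d → ∀ c₀, R c₀ d₀ → ∃ w' c, M.Run c₀ w' c ∧ R c d := by
    intro d₀ w d h
    induction h with
    | nil d => exact fun c h => ⟨[], c, .nil c, h⟩
    | eps s _ ih | read s _ ih =>
      intro c hc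
      obtain ⟨b, c', hs, hc', -⟩ := hR _ _ _ _ hc s
      obtain ⟨w', c'', hr, hc''⟩ := ih c' hc'
      cases b with
      | none => exact ⟨w', c'', .eps hs hr, hc''⟩
      | some b => exact ⟨b :: w', c'', .read hs hr, hc''⟩
  have heps : ∀ n d d', N.EpsRun n d d' → ∀ c, R c d → ∃ c', M.EpsRun n c c' := by
    intro n d d' h
    induction h with
    | nil d => exact fun c _ => ⟨c, .nil c⟩
    | cons s _ ih =>
      intro c hc
      obtain ⟨b, c', hs, hc', hb⟩ := hR _ _ _ _ hc s
      obtain ⟨c'', hr⟩ := ih c' hc'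
      rw [hb rfl] at hs
      exact ⟨c'', .cons hs hr⟩
  obtain ⟨w', c, hr, hc⟩ := hrun _ _ _ hd _ h0
  obtain ⟨c', hrEps⟩ := heps _ _ _ he c hc
  exact hB _ _ hr _ _ hrEps

/-! ### Relabelling letters and adding unused counters -/

/-- Pad a family indexed by `Fin k` to one indexed by `Fin m` with a default value. -/
def pad {A : Type} (m : ℕ) (x : A) (c : Fin k → A) : Fin m → A :=
  fun i => if h : (i : ℕ) < k then c ⟨i, h⟩ else x

/-- Relabel the letters of `M` along `f` and let it use `m` counters. -/
def relabel (f : α → β) (m : ℕ) (M : CAuto α k) : CAuto β m where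
  Q := M.Q
  fintypeQ := M.fintypeQ
  start := M.start
  accept := M.accept
  trans := M.trans.map fun t =>
    ⟨t.src, t.tgt, t.input.map f, pad m 0 t.add, pad m none t.guard, pad m false t.reset⟩

theorem pad_zero : pad m (0 : ℤ) (fun _ : Fin k => 0) = fun _ => 0 := by
  funext i
  simp [pad]

theorem pad_injective {A : Type} (hkm : k ≤ m) (x : A) :
    Function.Injective (pad m x : (Fin k → A) → _) := by
  intro c d h
  funext i
  simpa [pad] using congrFun h (Fin.castLE hkm i)

theorem relabel_step (f : α → β) (hkm : k ≤ m) (M : CAuto α k) (q : M.Q) (c : Fin k → ℤ)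
    (a : Option β) (d' : M.Q × (Fin m → ℤ)) :
    (M.relabel f m).Step (q, pad m 0 c) a d' ↔
      ∃ b c', M.Step (q, c) b c' ∧ a = b.map f ∧ d' = (c'.1, pad m 0 c'.2) := by
  have hguard : ∀ (t : CTrans α M.Q k) , GuardOK (α := β) (k := m)
      (Q := M.Q) ⟨t.src, t.tgt, t.input.map f, pad m 0 t.add, pad m none t.guard,
        pad m false t.reset⟩ (pad m 0 c) ↔ GuardOK t c := by
    intro t
    constructor
    · intro h i
      simpa [pad] using h (Fin.castLE hkm i)
    · intro h i
      by_cases hi : (i : ℕ) < k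
      · simpa [pad, hi] using h ⟨i, hi⟩
      · simp [pad, hi]
  have happ : ∀ (t : CTrans α M.Q k) , applyC (α := β) (k := m)
      (Q := M.Q) ⟨t.src, t.tgt, t.input.map f, pad m 0 t.add, pad m none t.guard,
        pad m false t.reset⟩ (pad m 0 c) = pad m 0 (applyC t c) := by
    intro t
    funext i
    by_cases hi : (i : ℕ) < k <;> simp [pad, applyC, hi]
  constructor
  · rintro ⟨t', ht', hs, rfl, hg, rfl⟩
    obtain ⟨t, ht, rfl⟩ := List.mem_map.1 ht'
    exact ⟨t.input, (t.tgt, applyC t c), ⟨t, ht, hs, rfl, (hguard t).1 hg, rfl⟩, rfl,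
      Prod.ext rfl (happ t)⟩
  · rintro ⟨b, c', ⟨t, ht, hs, rfl, hg, rfl⟩, rfl, rfl⟩
    exact ⟨_, List.mem_map.2 ⟨t, ht, rfl⟩, hs, rfl, (hguard t).2 hg, Prod.ext rfl (happ t).symm⟩

theorem relabel_run (f : α → β) (hkm : k ≤ m) (M : CAuto α k) (c : M.Q × (Fin k → ℤ))
    (w : List β) (d' : M.Q × (Fin m → ℤ)) :
    (M.relabel f m).Run (c.1, pad m 0 c.2) w d' ↔
      ∃ u c', M.Run c u c' ∧ w = u.map f ∧ d' = (c'.1, pad m 0 c'.2) := by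
  constructor
  · intro h
    generalize hd : ((c.1, pad m 0 c.2) : (M.relabel f m).Q × _) = d at h
    induction h generalizing c with
    | nil => exact ⟨[], c, .nil c, rfl, hd.symm⟩
    | eps s _ ih =>
      subst hd
      obtain ⟨b, c', hs, hb, rfl⟩ := (relabel_step f hkm M _ _ _ _).1 s
      obtain ⟨u, c'', hr, rfl, rfl⟩ := ih c' rfl
      cases b with
      | none => exact ⟨u, c'', .eps hs hr, rfl, rfl⟩
      | some b => simp at hb
    | read s _ ih =>
      subst hd
      obtain ⟨b, c', hs, hb, rfl⟩ := (relabel_step f hkm M _ _ _ _).1 s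
      obtain ⟨u, c'', hr, rfl, rfl⟩ := ih c' rfl
      cases b with
      | none => simp at hb
      | some b =>
        obtain rfl := Option.some_injective _ hb
        exact ⟨b :: u, c'', .read hs hr, rfl, rfl⟩
  · rintro ⟨u, c', h, rfl, rfl⟩
    induction h with
    | nil c => exact .nil _
    | eps s _ ih => exact .eps ((relabel_step f hkm M _ _ _ _).2 ⟨_, _, s, rfl, rfl⟩) ih
    | read s _ ih => exact .read ((relabel_step f hkm M _ _ _ _).2 ⟨_, _, s, rfl, rfl⟩) ih

theorem relabel_startConfig (f : α → β) (M : CAuto α k) :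
    (M.relabel f m).startConfig = (M.start, pad m 0 (fun _ : Fin k => 0)) := by
  rw [pad_zero]; rfl

/-! ### Product with a deterministic finite automaton -/

/-- The transitions of the product of `M` with the finite automaton `D`. -/
noncomputable def prodTrans {σ : Type} [Fintype σ] (M : CAuto α k) (D : DFA α σ) :
    List (CTrans α (M.Q × σ) k) :=
  M.trans.flatMap fun t => Finset.univ.toList.map fun s =>
    ⟨(t.src, s), (t.tgt, t.input.elim s (D.step s)), t.input, t.add, t.guard, t.reset⟩

theorem mem_prodTrans {σ : Type} [Fintype σ] {M : CAuto α k} {D : DFA α σ}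
    {t' : CTrans α (M.Q × σ) k} :
    t' ∈ M.prodTrans D ↔ ∃ t ∈ M.trans, ∃ s, t' =
      ⟨(t.src, s), (t.tgt, t.input.elim s (D.step s)), t.input, t.add, t.guard, t.reset⟩ := by
  simp [prodTrans, eq_comm]

/-- Run `M` in parallel with the finite automaton `D`. -/
noncomputable def prodDFA {σ : Type} [Fintype σ] (M : CAuto α k) (D : DFA α σ) : CAuto α k where
  Q := M.Q × σ
  fintypeQ := have := M.fintypeQ; inferInstance
  start := (M.start, D.start)
  accept := fun q => M.accept q.1 && @decide (q.2 ∈ D.accept) (Classical.dec _)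
  trans := M.prodTrans D

theorem prodDFA_step {σ : Type} [Fintype σ] (M : CAuto α k) (D : DFA α σ)
    (c : (M.Q × σ) × (Fin k → ℤ)) (a : Option α) (d : (M.Q × σ) × (Fin k → ℤ)) :
    (M.prodDFA D).Step c a d ↔
      M.Step (c.1.1, c.2) a (d.1.1, d.2) ∧ d.1.2 = a.elim c.1.2 (D.step c.1.2) := by
  obtain ⟨⟨q, s⟩, c⟩ := c
  obtain ⟨⟨q', s'⟩, c'⟩ := d
  constructor
  · rintro ⟨t', ht', hs, rfl, hg, hd⟩
    obtain ⟨t, ht, s₁, rfl⟩ := mem_prodTrans.1 ht'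
    obtain ⟨rfl, rfl⟩ := Prod.mk.inj hs
    obtain ⟨h1, rfl⟩ := Prod.mk.inj hd
    obtain ⟨rfl, rfl⟩ := Prod.mk.inj h1
    exact ⟨⟨t, ht, rfl, rfl, hg, rfl⟩, rfl⟩
  · rintro ⟨⟨t, ht, hs, rfl, hg, hd⟩, hs'⟩
    obtain ⟨rfl, rfl⟩ := Prod.mk.inj hd
    dsimp only at hs hs'
    subst hs hs'
    refine ⟨⟨(t.src, s), (t.tgt, t.input.elim s (D.step s)), t.input, t.add, t.guard, t.reset⟩,
      mem_prodTrans.2 ⟨t, ht, s, rfl⟩, rfl, rfl, hg, rfl⟩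

theorem prodDFA_run {σ : Type} [Fintype σ] (M : CAuto α k) (D : DFA α σ)
    (c : (M.prodDFA D).Q × (Fin k → ℤ)) (w : List α) (d : (M.prodDFA D).Q × (Fin k → ℤ)) :
    (M.prodDFA D).Run c w d ↔
      M.Run (c.1.1, c.2) w (d.1.1, d.2) ∧ d.1.2 = D.evalFrom c.1.2 w := by
  constructor
  · intro h
    induction h with
    | nil c => exact ⟨.nil _, rfl⟩
    | eps s _ ih =>
      obtain ⟨hs, he⟩ := (prodDFA_step M D _ _ _).1 s
      exact ⟨.eps hs ih.1, by rw [ih.2, he]; rfl⟩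
    | read s _ ih =>
      obtain ⟨hs, he⟩ := (prodDFA_step M D _ _ _).1 s
      exact ⟨.read hs ih.1, by rw [ih.2, he]; rfl⟩
  · obtain ⟨⟨q, s⟩, c⟩ := c
    obtain ⟨⟨q', s'⟩, c'⟩ := d
    rintro ⟨h, he⟩
    dsimp only at h he
    generalize hc : (q, c) = x, hd : (q', c') = y at h
    induction h generalizing q c s with
    | nil =>
      obtain ⟨rfl, rfl⟩ := Prod.mk.inj (hc.trans hd.symm)
      obtain rfl : s' = s := he
      exact .nil _
    | @eps _ x' _ _ st _ ih =>
      subst hc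
      exact .eps ((prodDFA_step M D _ _ ((x'.1, s), x'.2)).2 ⟨st, rfl⟩) (ih _ _ _ he rfl hd)
    | @read _ x' _ a _ st _ ih =>
      subst hc
      exact .read ((prodDFA_step M D _ _ ((x'.1, D.step s a), x'.2)).2 ⟨st, rfl⟩)
        (ih _ _ _ he rfl hd)

/-! ### Graphs of automata -/

section graph

variable {V : Type} [Fintype V]

/-- The transitions of the automaton `graph M I F E`. -/
noncomputable def graphTrans (M : V → CAuto α k) (I : V → Bool) (E : List (V × α × V)) :
    List (CTrans α (Option (Σ v, (M v).Q)) k) :=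
  (Finset.univ.toList.filter I).map (fun v =>
    ⟨none, some ⟨v, (M v).start⟩, none, fun _ => 0, fun _ => none, fun _ => false⟩) ++
  (Finset.univ.toList.flatMap (fun v => (M v).trans.map fun t =>
    ⟨some ⟨v, t.src⟩, some ⟨v, t.tgt⟩, t.input, t.add, t.guard, t.reset⟩) ++
  E.flatMap (fun e => ((@Finset.univ _ (M e.1).fintypeQ).toList.filter (M e.1).accept).map fun q =>
    ⟨some ⟨e.1, q⟩, some ⟨e.2.2, (M e.2.2).start⟩, some e.2.1, fun _ => 0, fun _ => some true,
      fun _ => false⟩))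

theorem mem_graphTrans {M : V → CAuto α k} {I : V → Bool} {E : List (V × α × V)}
    {t' : CTrans α (Option (Σ v, (M v).Q)) k} :
    t' ∈ graphTrans M I E ↔
      (∃ v, I v = true ∧ t' =
        ⟨none, some ⟨v, (M v).start⟩, none, fun _ => 0, fun _ => none, fun _ => false⟩) ∨
      (∃ v, ∃ t ∈ (M v).trans, t' =
        ⟨some ⟨v, t.src⟩, some ⟨v, t.tgt⟩, t.input, t.add, t.guard, t.reset⟩) ∨
      ∃ v b v', (v, b, v') ∈ E ∧ ∃ q, (M v).accept q = true ∧ t' =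
        ⟨some ⟨v, q⟩, some ⟨v', (M v').start⟩, some b, fun _ => 0, fun _ => some true,
          fun _ => false⟩ := by
  simp only [graphTrans, List.mem_append, List.mem_map, List.mem_flatMap, List.mem_filter,
    Finset.mem_toList, Finset.mem_univ, eq_comm (b := t'), true_and, Prod.exists]

/-- Traverse a finite graph whose vertices carry automata: a run passes through the automaton of
each vertex on a path, reading the label of each edge in between. -/
noncomputable def graph (M : V → CAuto α k) (I F : V → Bool) (E : List (V × α × V)) :
    CAuto α k where
  Q := Option (Σ v, (M v).Q)
  fintypeQ := have := fun v => (M v).fintypeQ; inferInstance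
  start := none
  accept := fun q => q.elim false fun p => F p.1 && (M p.1).accept p.2
  trans := graphTrans M I E

/-- Words spelled along paths of a graph with vertex languages `A`, edges `E` and final
vertices `F`. -/
inductive PathWord (A : V → Language α) (F : V → Bool) (E : List (V × α × V)) : V → List α → Prop
  | last {v w} : F v = true → w ∈ A v → PathWord A F E v w
  | cons {v w a v' w'} : w ∈ A v → (v, a, v') ∈ E → PathWord A F E v' w' →
      PathWord A F E v (w ++ a :: w')

variable {M : V → CAuto α k} {I F : V → Bool} {E : List (V × α × V)}

theorem graph_step_none {c : Fin k → ℤ} {a : Option α} {d : Option (Σ v, (M v).Q) × (Fin k → ℤ)} :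
    (graph M I F E).Step (none, c) a d ↔
      a = none ∧ ∃ v, I v = true ∧ d = (some ⟨v, (M v).start⟩, c) := by
  constructor
  · rintro ⟨t, ht, hs, rfl, hg, rfl⟩
    obtain ⟨v, hv, rfl⟩ | ⟨v, t, ht, rfl⟩ | ⟨v, b, v', he, q, -, rfl⟩ := mem_graphTrans.1 ht
    · exact ⟨rfl, v, hv, Prod.ext rfl (funext fun i => add_zero _)⟩
    · cases hs
    · cases hs
  · rintro ⟨rfl, v, hv, rfl⟩
    exact ⟨_, mem_graphTrans.2 (Or.inl ⟨v, hv, rfl⟩), rfl, rfl, by simp [GuardOK],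
      Prod.ext rfl (funext fun i => (add_zero _).symm)⟩

theorem graph_step_some {v : V} {q : (M v).Q} {c : Fin k → ℤ} {a : Option α}
    {d : Option (Σ v, (M v).Q) × (Fin k → ℤ)} :
    (graph M I F E).Step (some ⟨v, q⟩, c) a d ↔
      (∃ d', (M v).Step (q, c) a d' ∧ d = (some ⟨v, d'.1⟩, d'.2)) ∨
      ∃ b v', a = some b ∧ (v, b, v') ∈ E ∧ (M v).accept q = true ∧ c = (fun _ => 0) ∧
        d = (some ⟨v', (M v').start⟩, fun _ => 0) := by
  constructor
  · rintro ⟨t, ht, hs, rfl, hg, rfl⟩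
    obtain ⟨v', hv, rfl⟩ | ⟨v', t, ht', rfl⟩ | ⟨v', b, v'', he, q', hq, rfl⟩ :=
      mem_graphTrans.1 ht
    · cases hs
    · cases hs
      exact Or.inl ⟨_, ⟨t, ht', rfl, rfl, hg, rfl⟩, rfl⟩
    · cases hs
      obtain rfl : c = fun _ => 0 := funext fun i => (hg i).1 rfl
      exact Or.inr ⟨b, v'', rfl, he, hq, rfl, Prod.ext rfl (funext fun i => add_zero _)⟩
  · rintro (⟨d', ⟨t, ht, hs, rfl, hg, rfl⟩, rfl⟩ | ⟨b, v', rfl, he, hq, rfl, rfl⟩)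
    · dsimp only at hs
      subst hs
      exact ⟨_, mem_graphTrans.2 (Or.inr (Or.inl ⟨v, t, ht, rfl⟩)), rfl, rfl, hg, rfl⟩
    · exact ⟨_, mem_graphTrans.2 (Or.inr (Or.inr ⟨v, b, v', he, q, hq, rfl⟩)), rfl, rfl,
        by simp [GuardOK], Prod.ext rfl (funext fun i => (add_zero _).symm)⟩

theorem graph_run_lift {v : V} {c d : (M v).Q × (Fin k → ℤ)} {w : List α} (h : (M v).Run c w d) :
    (graph M I F E).Run (some ⟨v, c.1⟩, c.2) w (some ⟨v, d.1⟩, d.2) := by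
  induction h with
  | nil c => exact .nil _
  | eps s _ ih => exact .eps (graph_step_some.2 (Or.inl ⟨_, s, rfl⟩)) ih
  | read s _ ih => exact .read (graph_step_some.2 (Or.inl ⟨_, s, rfl⟩)) ih

theorem graph_run_of_pathWord {v : V} {w : List α}
    (h : PathWord (fun v => (M v).lang) F E v w) :
    ∃ v' q', F v' = true ∧ (M v').accept q' = true ∧
      (graph M I F E).Run (some ⟨v, (M v).start⟩, fun _ => 0) w (some ⟨v', q'⟩, fun _ => 0) := by
  induction h with
  | @last v w hF hw =>
    obtain ⟨q, hr, ha⟩ := mem_lang_iff.1 hw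
    exact ⟨v, q, hF, ha, graph_run_lift hr⟩
  | @cons v w a v' w' hw he _ ih =>
    obtain ⟨q, hr, ha⟩ := mem_lang_iff.1 hw
    obtain ⟨v'', q', hF, ha', hr'⟩ := ih
    exact ⟨v'', q', hF, ha', (graph_run_lift hr).append
      (.read (graph_step_some.2 (Or.inr ⟨a, v', rfl, he, ha, rfl, rfl⟩)) hr')⟩

theorem pathWord_of_graph_run {v v' : V} {q : (M v).Q} {q' : (M v').Q} {c : Fin k → ℤ} {w : List α}
    (hF : F v' = true) (ha : (M v').accept q' = true)
    (h : (graph M I F E).Run (some ⟨v, q⟩, c) w (some ⟨v', q'⟩, fun _ => 0)) :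
    ∃ w₁ q₁, (M v).Run (q, c) w₁ (q₁, fun _ => 0) ∧ (M v).accept q₁ = true ∧
      (F v = true ∧ w = w₁ ∨ ∃ a v₁ w₂, (v, a, v₁) ∈ E ∧
        PathWord (fun v => (M v).lang) F E v₁ w₂ ∧ w = w₁ ++ a :: w₂) := by
  generalize hx : ((some ⟨v, q⟩, c) : (graph M I F E).Q × (Fin k → ℤ)) = x,
    hy : ((some ⟨v', q'⟩, fun _ => 0) : (graph M I F E).Q × (Fin k → ℤ)) = y at h
  induction h generalizing v q c with
  | nil =>
    cases hx.trans hy.symm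
    exact ⟨[], _, .nil _, ha, Or.inl ⟨hF, rfl⟩⟩
  | eps s _ ih =>
    subst hx
    obtain ⟨d', hs, rfl⟩ | ⟨b, v', hb, -⟩ := graph_step_some.1 s
    · obtain ⟨w₁, q₁, hr, ha₁, h⟩ := ih rfl hy
      exact ⟨w₁, q₁, .eps hs hr, ha₁, h⟩
    · cases hb
  | @read _ _ _ a w s _ ih =>
    subst hx
    obtain ⟨d', hs, rfl⟩ | ⟨b, v₁, hb, he, hq, rfl, rfl⟩ := graph_step_some.1 s
    · obtain ⟨w₁, q₁, hr, ha₁, h⟩ := ih rfl hy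
      refine ⟨a :: w₁, q₁, .read hs hr, ha₁, h.imp ?_ ?_⟩
      · rintro ⟨hF, rfl⟩
        exact ⟨hF, rfl⟩
      · rintro ⟨b, v₁, w₂, he, hp, rfl⟩
        exact ⟨b, v₁, w₂, he, hp, rfl⟩
    · cases hb
      obtain ⟨w₁, q₁, hr, ha₁, h⟩ := ih rfl hy
      refine ⟨[], q, .nil _, hq, Or.inr ⟨a, v₁, w, he, ?_, rfl⟩⟩
      have hw₁ : w₁ ∈ (M v₁).lang := mem_lang_iff.2 ⟨q₁, hr, ha₁⟩
      obtain ⟨hF, rfl⟩ | ⟨b, v₂, w₂, he, hp, rfl⟩ := h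
      · exact .last hF hw₁
      · exact .cons hw₁ he hp

theorem graph_lang :
    (graph M I F E).lang =
      {w | ∃ v, I v = true ∧ PathWord (fun v => (M v).lang) F E v w} := by
  ext w
  rw [mem_lang_iff]
  constructor
  · rintro ⟨q, hr, ha⟩
    obtain _ | ⟨v', q'⟩ := q
    · cases ha
    · obtain ⟨hF, ha⟩ := Bool.and_eq_true_iff.1 ha
      generalize hx : (graph M I F E).startConfig = x at hr
      cases hr with
      | nil => cases hx
      | eps s h =>
        subst hx
        obtain ⟨-, v, hv, rfl⟩ := graph_step_none.1 s
        refine ⟨v, hv, ?_⟩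
        obtain ⟨w₁, q₁, hr, ha₁, h⟩ := pathWord_of_graph_run hF ha h
        have hw₁ : w₁ ∈ (M v).lang := mem_lang_iff.2 ⟨q₁, hr, ha₁⟩
        obtain ⟨hF, rfl⟩ | ⟨b, v₂, w₂, he, hp, rfl⟩ := h
        · exact .last hF hw₁
        · exact .cons hw₁ he hp
      | read s h =>
        subst hx
        cases (graph_step_none.1 s).1
  · rintro ⟨v, hv, hp⟩
    obtain ⟨v', q', hF, ha, hr⟩ := graph_run_of_pathWord (I := I) hp
    exact ⟨some ⟨v', q'⟩, .eps (graph_step_none.2 ⟨rfl, v, hv, rfl⟩) hr,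
      Bool.and_eq_true_iff.2 ⟨hF, ha⟩⟩

theorem graph_run_reachable {x : (graph M I F E).Q × (Fin k → ℤ)} {w : List α}
    {v : V} {q : (M v).Q} {c : Fin k → ℤ}
    (h : (graph M I F E).Run x w (some ⟨v, q⟩, c))
    (hx : x = (none, fun _ => 0) ∨
      ∃ v q c u, x = (some ⟨v, q⟩, c) ∧ (M v).Run (M v).startConfig u (q, c)) :
    ∃ u, (M v).Run (M v).startConfig u (q, c) := by
  have key : ∀ x a x', (graph M I F E).Step x a x' →
      (x = (none, fun _ => 0) ∨
        ∃ v q c u, x = (some ⟨v, q⟩, c) ∧ (M v).Run (M v).startConfig u (q, c)) →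
      ∃ v q c u, x' = (some ⟨v, q⟩, c) ∧ (M v).Run (M v).startConfig u (q, c) := by
    rintro x a x' s (rfl | ⟨v, q, c, u, rfl, hr⟩)
    · obtain ⟨-, v, -, rfl⟩ := graph_step_none.1 s
      exact ⟨v, _, _, [], rfl, .nil _⟩
    · obtain ⟨d', hs, rfl⟩ | ⟨b, v', -, -, -, -, rfl⟩ := graph_step_some.1 s
      · cases a with
        | none => exact ⟨v, _, _, u ++ [], rfl, hr.append (.eps hs (.nil _))⟩
        | some a => exact ⟨v, _, _, u ++ [a], rfl, hr.append (.read hs (.nil _))⟩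
      · exact ⟨v', _, _, [], rfl, .nil _⟩
  generalize hy : ((some ⟨v, q⟩, c) : (graph M I F E).Q × (Fin k → ℤ)) = y at h
  induction h with
  | nil =>
    subst hy
    obtain hx | ⟨v, q, c, u, hx, hr⟩ := hx
    · cases hx
    · cases hx
      exact ⟨u, hr⟩
  | eps s _ ih | read s _ ih => exact ih (Or.inr (key _ _ _ s hx)) hy

theorem graph_epsRun {v : V} {q : (M v).Q} {c : Fin k → ℤ} {n : ℕ}
    {y : (graph M I F E).Q × (Fin k → ℤ)}
    (h : (graph M I F E).EpsRun n (some ⟨v, q⟩, c) y) : ∃ d, (M v).EpsRun n (q, c) d := by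
  generalize hx : ((some ⟨v, q⟩, c) : (graph M I F E).Q × (Fin k → ℤ)) = x at h
  induction h generalizing q c with
  | nil => exact ⟨_, .nil _⟩
  | cons s _ ih =>
    subst hx
    obtain ⟨d', hs, rfl⟩ | ⟨b, v', hb, -⟩ := graph_step_some.1 s
    · obtain ⟨d, hd⟩ := ih rfl
      exact ⟨d, .cons hs hd⟩
    · cases hb

theorem graph_quasiRealtime (hM : ∀ v, (M v).QuasiRealtime) : (graph M I F E).QuasiRealtime := by
  choose B hB using fun v => quasiRealtime_iff.1 (hM v)
  have hle : ∀ v, B v ≤ ∑ v, B v := fun v =>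
    Finset.single_le_sum (fun _ _ => Nat.zero_le _) (Finset.mem_univ v)
  refine quasiRealtime_iff.2 ⟨∑ v, B v + 1, ?_⟩
  rintro w ⟨_ | ⟨v, q⟩, c⟩ hr n y he
  · generalize hx : ((none, c) : (graph M I F E).Q × (Fin k → ℤ)) = x at he
    cases he with
    | nil => exact Nat.zero_le _
    | cons s h =>
      subst hx
      obtain ⟨-, v, -, rfl⟩ := graph_step_none.1 s
      have hr' := hr.append (.eps s (.nil _))
      obtain ⟨u, hu⟩ := graph_run_reachable hr' (Or.inl rfl)
      obtain ⟨d, hd⟩ := graph_epsRun h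
      exact Nat.succ_le_succ ((hB v _ _ hu _ _ hd).trans (hle v))
  · obtain ⟨u, hu⟩ := graph_run_reachable hr (Or.inl rfl)
    obtain ⟨d, hd⟩ := graph_epsRun he
    exact ((hB v _ _ hu _ _ hd).trans (hle v)).trans (Nat.le_succ _)

end graph

end CAuto

/-! ### Closure properties of `Sclass` -/

section closure

open CAuto

variable {α β : Type} {k m : ℕ}

theorem Sclass.map {L : Language α} (hL : L ∈ Sclass k α) (hkm : k ≤ m) (f : α → β) :
    List.map f '' L ∈ Sclass m β := by
  obtain ⟨M, hM, rfl⟩ := hL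
  refine ⟨M.relabel f m, hM.of_simulation (fun c d => d = (c.1, pad m 0 c.2))
    (M.relabel_startConfig f) ?_, ?_⟩
  · rintro ⟨q, c⟩ _ a d' rfl s
    obtain ⟨b, c', hs, rfl, rfl⟩ := (relabel_step f hkm M q c _ _).1 s
    exact ⟨b, c', hs, rfl, by simp⟩
  · ext w
    rw [mem_lang_iff, relabel_startConfig]
    constructor
    · rintro ⟨q, hr, ha⟩
      obtain ⟨u, ⟨q', c⟩, hr', rfl, hd⟩ := (relabel_run f hkm M M.startConfig _ _).1 hr
      obtain ⟨rfl, hc⟩ := Prod.mk.inj hd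
      obtain rfl : c = fun _ => 0 := pad_injective hkm 0 (hc.symm.trans pad_zero.symm)
      exact ⟨u, mem_lang_iff.2 ⟨_, hr', ha⟩, rfl⟩
    · rintro ⟨u, hu, rfl⟩
      obtain ⟨q, hr, ha⟩ := mem_lang_iff.1 hu
      exact ⟨q, (relabel_run f hkm M M.startConfig _ _).2
        ⟨u, _, hr, rfl, Prod.ext rfl pad_zero.symm⟩, ha⟩

theorem Sclass.inter_isRegular {L R : Language α} (hL : L ∈ Sclass k α) (hR : R.IsRegular) :
    {w | w ∈ L ∧ w ∈ R} ∈ Sclass k α := by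
  obtain ⟨M, hM, rfl⟩ := hL
  obtain ⟨σ, _, D, rfl⟩ := hR
  refine ⟨M.prodDFA D, hM.of_simulation (fun c d => c = (d.1.1, d.2)) rfl ?_, ?_⟩
  · rintro _ d a d' rfl s
    exact ⟨a, _, ((prodDFA_step M D _ _ _).1 s).1, rfl, id⟩
  · ext w
    change _ ↔ w ∈ M.lang ∧ w ∈ D.accepts
    rw [mem_lang_iff, mem_lang_iff]
    constructor
    · rintro ⟨q, hr, ha⟩
      obtain ⟨hr, he⟩ := (prodDFA_run M D _ _ _).1 hr
      obtain ⟨ha, hd⟩ := Bool.and_eq_true_iff.1 ha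
      refine ⟨⟨q.1, hr, ha⟩, ?_⟩
      dsimp only at he
      rw [he] at hd
      exact @of_decide_eq_true _ (Classical.dec _) hd
    · rintro ⟨⟨q, hr, ha⟩, hw⟩
      exact ⟨(q, D.eval w), (prodDFA_run M D _ _ ((q, D.eval w), _)).2 ⟨hr, rfl⟩,
        Bool.and_eq_true_iff.2 ⟨ha, @decide_eq_true _ (Classical.dec _) hw⟩⟩

theorem Language.isRegular_singleton (w : List α) : Language.IsRegular ({w} : Set (List α)) := by
  refine .of_finite_range_leftQuotient (((Set.finite_singleton (∅ : Set (List α))).union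
    (w.tails.finite_toSet.image fun s => ({s} : Set (List α)))).subset ?_)
  rintro _ ⟨u, rfl⟩
  by_cases h : ∃ s, u ++ s = w
  · obtain ⟨s, rfl⟩ := h
    refine Or.inr ⟨s, by simp, ?_⟩
    ext t
    change t = s ↔ u ++ t = u ++ s
    simp
  · refine Or.inl ?_
    ext t
    change u ++ t = w ↔ False
    exact ⟨fun ht => h ⟨t, ht⟩, False.elim⟩

theorem Sclass.sdiff_singleton {L : Language α} (hL : L ∈ Sclass k α) (w : List α) :
    {u | u ∈ L ∧ u ≠ w} ∈ Sclass k α :=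
  Sclass.inter_isRegular hL (Language.isRegular_singleton w).compl

theorem Sclass.pathWord {V : Type} [Fintype V] {A : V → Language α} (hA : ∀ v, A v ∈ Sclass k α)
    (I F : V → Bool) (E : List (V × α × V)) :
    {w | ∃ v, I v = true ∧ PathWord A F E v w} ∈ Sclass k α := by
  choose M hM hMA using hA
  obtain rfl : (fun v => (M v).lang) = A := funext hMA
  exact ⟨graph M I F E, graph_quasiRealtime hM, graph_lang⟩

theorem Sclass.union {A B : Set (List α)} (hA : A ∈ Sclass k α) (hB : B ∈ Sclass k α) :
    A ∪ B ∈ Sclass k α := by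
  convert Sclass.pathWord (V := Bool) (A := fun b => if b then A else B)
    (by rintro (_ | _) <;> simpa) (fun _ => true) (fun _ => true) [] using 1
  ext w
  constructor
  · rintro (h | h)
    · exact ⟨true, rfl, .last rfl h⟩
    · exact ⟨false, rfl, .last rfl h⟩
  · rintro ⟨_ | _, -, h⟩ <;> cases h
    · exact Or.inr ‹_›
    · simp_all
    · exact Or.inl ‹_›
    · simp_all

/-- The language `A a B`. -/
def sepConcat (A : Set (List α)) (a : α) (B : Set (List α)) : Set (List α) :=
  {w | ∃ u ∈ A, ∃ v ∈ B, w = u ++ a :: v}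

/-- The language `A (a B)*`. -/
inductive SepStar (A : Set (List α)) (a : α) (B : Set (List α)) : List α → Prop
  | base {u} : u ∈ A → SepStar A a B u
  | snoc {u v} : SepStar A a B u → v ∈ B → SepStar A a B (u ++ a :: v)

theorem Sclass.sepConcat {A B : Set (List α)} (hA : A ∈ Sclass k α) (a : α)
    (hB : B ∈ Sclass k α) : sepConcat A a B ∈ Sclass k α := by
  convert Sclass.pathWord (V := Bool) (A := fun b => if b then A else B)
    (by rintro (_ | _) <;> simpa) id not [(true, a, false)] using 1
  ext w
  constructor
  · rintro ⟨u, hu, v, hv, rfl⟩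
    exact ⟨true, rfl, .cons hu (v' := false) (by simp) (.last rfl hv)⟩
  · rintro ⟨v, hv, h⟩
    obtain rfl : v = true := hv
    cases h with
    | last h => cases h
    | cons hu he h =>
      obtain ⟨rfl, rfl⟩ : _ ∧ _ := by simpa using he
      cases h with
      | last _ hv => exact ⟨_, hu, _, hv, rfl⟩
      | cons _ he => simp at he

theorem Sclass.sepStar {A B : Set (List α)} (hA : A ∈ Sclass k α) (a : α)
    (hB : B ∈ Sclass k α) : {w | SepStar A a B w} ∈ Sclass k α := by
  convert Sclass.pathWord (V := Bool) (A := fun b => if b then A else B)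
    (by rintro (_ | _) <;> simpa) id (fun _ => true) [(true, a, false), (false, a, false)] using 1
  have hsnoc : ∀ x w, PathWord (fun b => if b then A else B) (fun _ => true)
      [(true, a, false), (false, a, false)] x w → ∀ v ∈ B,
      PathWord (fun b => if b then A else B) (fun _ => true)
        [(true, a, false), (false, a, false)] x (w ++ a :: v) := by
    intro x w h v hv
    induction h with
    | @last x w _ h =>
      exact .cons h (by cases x <;> simp) (.last (v := false) rfl hv)
    | cons h he _ ih =>
      rw [List.append_assoc, List.cons_append]
      exact .cons h he ih
  have hpre : ∀ x w, PathWord (fun b => if b then A else B) (fun _ => true)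
      [(true, a, false), (false, a, false)] x w → x = false →
      ∀ u, SepStar A a B u → SepStar A a B (u ++ a :: w) := by
    intro x w h
    induction h with
    | last _ h => rintro rfl u hu; exact .snoc hu h
    | @cons v w b v' w' h he _ ih =>
      rintro rfl u hu
      obtain ⟨rfl, rfl⟩ : b = a ∧ v' = false := by simpa using he
      simpa using ih rfl _ (.snoc hu h)
  ext w
  constructor
  · intro h
    refine ⟨true, rfl, ?_⟩
    induction h with
    | base h => exact .last rfl h
    | snoc _ hv ih => exact hsnoc _ _ ih _ hv
  · rintro ⟨v, hv, h⟩
    obtain rfl : v = true := hv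
    cases h with
    | last _ h => exact .base h
    | @cons _ _ b v' _ h he h' =>
      obtain ⟨rfl, rfl⟩ : b = a ∧ v' = false := by simpa using he
      exact hpre _ _ h' rfl _ (.base h)

theorem Sclass.singleton_nil : ({[]} : Set (List α)) ∈ Sclass k α := by
  have hstep : ∀ c a d, ¬ (⟨Unit, (), fun _ => true, []⟩ : CAuto α k).Step c a d := by
    rintro c a d ⟨t, ht, -⟩
    cases ht
  refine ⟨⟨Unit, (), fun _ => true, []⟩, quasiRealtime_iff.2 ⟨0, ?_⟩, ?_⟩
  · rintro w c - n d (_ | ⟨s, _⟩)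
    · rfl
    · exact (hstep _ _ _ s).elim
  · ext w
    rw [mem_lang_iff]
    constructor
    · rintro ⟨q, h, -⟩
      cases h with
      | nil => rfl
      | eps s => exact (hstep _ _ _ s).elim
      | read s => exact (hstep _ _ _ s).elim
    · rintro rfl
      exact ⟨(), .nil _, rfl⟩

theorem Sclass.singleton (w : List α) : ({w} : Set (List α)) ∈ Sclass k α := by
  induction w with
  | nil => exact Sclass.singleton_nil
  | cons a w ih =>
    convert Sclass.sepConcat Sclass.singleton_nil a ih using 1
    ext u
    simp [_root_.sepConcat]

end closure
/-! ### Convolutions -/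

section conv

variable {A B A' B' : Type}

theorem conv_cons_cons (a : A) (b : B) (u : List A) (v : List B) :
    conv (a :: u) (b :: v) = (some a, some b) :: conv u v := by
  simp only [conv, List.length_cons, Nat.add_max_add_right, List.range_succ_eq_map]
  simp

theorem conv_nil_left (v : List B) : conv ([] : List A) v = v.map fun b => (none, some b) := by
  apply List.ext_getElem <;> simp +contextual [conv]

theorem conv_nil_right (u : List A) : conv u ([] : List B) = u.map fun a => (some a, none) := by
  apply List.ext_getElem <;> simp +contextual [conv]

theorem conv_append_append (p u v : List A) :
    conv (p ++ u) (p ++ v) = p.map (fun a => (some a, some a)) ++ conv u v := by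
  induction p with
  | nil => rfl
  | cons a p ih => simp [conv_cons_cons, ih]

theorem conv_self (u : List A) : conv u u = u.map fun a => (some a, some a) := by
  simpa [conv_nil_left] using conv_append_append u [] []

theorem conv_self_append (p v : List A) :
    conv p (p ++ v) = p.map (fun a => (some a, some a)) ++ v.map fun b => (none, some b) := by
  simpa [conv_nil_left] using conv_append_append p [] v

theorem conv_append_self (p u : List A) :
    conv (p ++ u) p = p.map (fun a => (some a, some a)) ++ u.map fun b => (some b, none) := by
  simpa [conv_nil_right] using conv_append_append p u []

theorem conv_map_map (f : A → A') (g : B → B') (u : List A) (v : List B) :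
    conv (u.map f) (v.map g) = (conv u v).map (Prod.map (Option.map f) (Option.map g)) := by
  simp [conv]

theorem filterMap_fst_conv (u : List A) (v : List B) : (conv u v).filterMap Prod.fst = u := by
  induction u generalizing v with
  | nil => simp [conv_nil_left]
  | cons a u ih =>
    cases v with
    | nil => simp [conv_nil_right]
    | cons b v => simp [conv_cons_cons, ih]

theorem filterMap_snd_conv (u : List A) (v : List B) : (conv u v).filterMap Prod.snd = v := by
  induction v generalizing u with
  | nil => simp [conv_nil_right]
  | cons b v ih =>
    cases u with
    | nil => simp [conv_nil_left]
    | cons a u => simp [conv_cons_cons, ih]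

theorem conv_inj {u u' : List A} {v v' : List B} :
    conv u v = conv u' v' ↔ u = u' ∧ v = v' := by
  refine ⟨fun h => ⟨?_, ?_⟩, by rintro ⟨rfl, rfl⟩; rfl⟩
  · rw [← filterMap_fst_conv u v, h, filterMap_fst_conv]
  · rw [← filterMap_snd_conv u v, h, filterMap_snd_conv]

end conv

/-- `S_k`-graph automaticity in terms of the map sending a group element to its normal form. -/
theorem sGraphAutomatic_iff {k : ℕ} {G Λ : Type} [Group G] {X : Set G} :
    SGraphAutomatic k X Λ ↔ ∃ w : G → List Λ, Function.Injective w ∧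
      Set.range w ∈ Sclass k Λ ∧
      ∀ x ∈ X, Set.range (fun g => conv (w g) (w (g * x))) ∈ Sclass k (Option Λ × Option Λ) := by
  have hmult : ∀ (nf : List Λ → G) (w : G → List Λ), (∀ g, nf (w g) = g) → ∀ x,
      Mult nf (Set.range w) x = Set.range (fun g => conv (w g) (w (g * x))) := by
    intro nf w h x
    ext c
    constructor
    · rintro ⟨_, ⟨g, rfl⟩, _, ⟨g', rfl⟩, he, rfl⟩
      rw [h, h] at he
      exact ⟨g, by simp [he]⟩
    · rintro ⟨g, rfl⟩
      exact ⟨_, ⟨g, rfl⟩, _, ⟨g * x, rfl⟩, by rw [h, h], rfl⟩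
  constructor
  · rintro ⟨L, nf, hbij, hL, hm⟩
    choose w hwL hw using fun g : G => hbij.surjOn (Set.mem_univ g)
    obtain rfl : Set.range w = L := by
      ext u
      refine ⟨by rintro ⟨g, rfl⟩; exact hwL g, fun hu => ⟨nf u, ?_⟩⟩
      exact hbij.injOn (hwL _) hu (hw _)
    exact ⟨w, Function.LeftInverse.injective hw, hL, fun x hx => hmult nf w hw x ▸ hm x hx⟩
  · rintro ⟨w, hw, hL, hm⟩
    have hinv := Function.leftInverse_invFun hw
    refine ⟨Set.range w, Function.invFun w, ⟨fun _ _ => Set.mem_univ _, ?_, ?_⟩, hL,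
      fun x hx => hmult _ w hinv x ▸ hm x hx⟩
    · rintro _ ⟨g, rfl⟩ _ ⟨g', rfl⟩ h
      rw [hinv, hinv] at h
      rw [h]
    · exact fun g _ => ⟨w g, ⟨g, rfl⟩, hinv g⟩

/-! ### Normal forms in a free product -/

open Classical in
/-- Append to `p` the separator and the block of `g`, unless `g` is trivial. -/
noncomputable def appendBlock {K B : Type} [Group K] (w : K → List B) (p : List (Option B)) (g : K) :
    List (Option B) :=
  if g = 1 then p else p ++ none :: (w g).map some

theorem Sclass.range_conv_appendBlock {K B : Type} [Group K] {k : ℕ} {w : K → List B}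
    (hw : Function.Injective w) {P : Set (List (Option B))} (hP : P ∈ Sclass k (Option B))
    (hL : Set.range w ∈ Sclass k B) {x : K}
    (hx : Set.range (fun g => conv (w g) (w (g * x))) ∈ Sclass k (Option B × Option B)) :
    {c | ∃ p ∈ P, ∃ g, c = conv (appendBlock w p g) (appendBlock w p (g * x))} ∈
      Sclass k (Option (Option B) × Option (Option B)) := by
  have hD := Sclass.map hP le_rfl fun a => (some a, some a)
  by_cases h1 : x = 1
  · subst h1
    have hW := Sclass.map (Sclass.sdiff_singleton hL (w 1)) le_rfl (some : B → Option B)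
    convert Sclass.map (Sclass.union hP (Sclass.sepConcat hP none hW)) le_rfl
      fun a => (some a, some a) using 1
    ext c
    constructor
    · rintro ⟨p, hp, g, rfl⟩
      refine ⟨appendBlock w p g, ?_, by rw [mul_one, conv_self]⟩
      by_cases hg : g = 1
      · exact Or.inl (by simpa [appendBlock, hg])
      · exact Or.inr ⟨p, hp, (w g).map some, ⟨w g, ⟨⟨g, rfl⟩, hw.ne hg⟩, rfl⟩,
          by simp [appendBlock, hg]⟩
    · rintro ⟨u, hp | ⟨p, hp, _, ⟨_, ⟨⟨g, rfl⟩, hg⟩, rfl⟩, rfl⟩, rfl⟩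
      · exact ⟨u, hp, 1, by simp [appendBlock, conv_self]⟩
      · have hg : g ≠ 1 := fun h => hg (h ▸ rfl)
        exact ⟨p, hp, g, by simp [appendBlock, hg, conv_self]⟩
  · have hM := Sclass.map (Sclass.sdiff_singleton (Sclass.sdiff_singleton hx (conv (w 1) (w x)))
      (conv (w x⁻¹) (w 1))) le_rfl (Prod.map (Option.map some) (Option.map (some : B → Option B)))
    convert Sclass.union (Sclass.sepConcat hD (some none, some none) hM)
      (Sclass.union (Sclass.sepConcat hD (none, some none)
          (Sclass.singleton ((w x).map fun b => (none, some (some b)))))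
        (Sclass.sepConcat hD (some none, none)
          (Sclass.singleton ((w x⁻¹).map fun b => (some (some b), none))))) using 1
    ext c
    constructor
    · rintro ⟨p, hp, g, rfl⟩
      by_cases hg : g = 1
      · refine Or.inr (Or.inl ⟨_, ⟨p, hp, rfl⟩, _, rfl, ?_⟩)
        simp [appendBlock, hg, h1, conv_self_append]
      · by_cases hgx : g * x = 1
        · refine Or.inr (Or.inr ⟨_, ⟨p, hp, rfl⟩, _, rfl, ?_⟩)
          simp [appendBlock, h1, conv_append_self, eq_inv_of_mul_eq_one_left hgx]
        · refine Or.inl ⟨_, ⟨p, hp, rfl⟩, _, ⟨_, ⟨⟨⟨g, rfl⟩, ?_⟩, ?_⟩, rfl⟩, ?_⟩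
          · exact fun h => hg (hw (conv_inj.1 h).1)
          · exact fun h => hgx (hw (conv_inj.1 h).2)
          · simp [appendBlock, hg, hgx, conv_append_append, conv_cons_cons, conv_map_map]
    · rintro (⟨_, ⟨p, hp, rfl⟩, _, ⟨_, ⟨⟨⟨g, rfl⟩, hg⟩, hgx⟩, rfl⟩, rfl⟩ |
        ⟨_, ⟨p, hp, rfl⟩, _, rfl, rfl⟩ | ⟨_, ⟨p, hp, rfl⟩, _, rfl, rfl⟩)
      · have hg : g ≠ 1 := by
          rintro rfl
          exact hg (by simp)
        have hgx : g * x ≠ 1 := by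
          intro h
          rw [eq_inv_of_mul_eq_one_left h] at hgx
          exact hgx (by simp)
        refine ⟨p, hp, g, ?_⟩
        simp [appendBlock, hg, hgx, conv_append_append, conv_cons_cons, conv_map_map]
      · exact ⟨p, hp, 1, by simp [appendBlock, h1, conv_self_append]⟩
      · exact ⟨p, hp, x⁻¹, by simp [appendBlock, h1, conv_append_self]⟩

/-- Alternating words in `G` and `H` that start and end with a letter from `G`, all letters but
possibly the first being nontrivial. -/
inductive AltWord (G H : Type) [Group G] [Group H]
  | base (g : G) : AltWord G H
  | snoc (n : AltWord G H) (h : {h : H // h ≠ 1}) (g : {g : G // g ≠ 1}) : AltWord G H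

namespace AltWord

variable {G H : Type} [Group G] [Group H]

open Monoid.Coprod

open Classical in
/-- The normal form of the product of `n`, `h` and `g`. -/
noncomputable def snocMul (n : AltWord G H) (h : {h : H // h ≠ 1}) (g : G) : AltWord G H × H :=
  if hg : g = 1 then (n, h) else (snoc n h ⟨g, hg⟩, 1)

open Classical in
/-- Right multiplication of a normal form by an element of `G`. -/
noncomputable def mulG (p : AltWord G H × H) (g : G) : AltWord G H × H :=
  if hh : p.2 = 1 then
    match p.1 with
    | base g₀ => (base (g₀ * g), 1)
    | snoc n h g₀ => snocMul n h (g₀ * g)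
  else snocMul p.1 ⟨p.2, hh⟩ g

theorem mulG_base (g₀ g : G) : mulG ((base g₀, 1) : AltWord G H × H) g = (base (g₀ * g), 1) := by
  simp [mulG]

theorem mulG_snocMul (n : AltWord G H) (h : {h : H // h ≠ 1}) (g₀ g : G) :
    mulG (snocMul n h g₀) g = snocMul n h (g₀ * g) := by
  by_cases hg : g₀ = 1
  · subst hg
    rw [one_mul]
    simp [snocMul, mulG, h.2]
  · simp [snocMul, mulG, hg]

theorem eq_base_or_snocMul (p : AltWord G H × H) :
    (∃ g, p = (base g, 1)) ∨ ∃ n h g, p = snocMul n h g := by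
  obtain ⟨n, h⟩ := p
  by_cases hh : h = 1
  · subst hh
    cases n with
    | base g => exact Or.inl ⟨g, rfl⟩
    | snoc n h g => exact Or.inr ⟨n, h, g, by simp [snocMul, g.2]⟩
  · exact Or.inr ⟨n, ⟨h, hh⟩, 1, by simp [snocMul]⟩

theorem mulG_one (p : AltWord G H × H) : mulG p 1 = p := by
  obtain ⟨g, rfl⟩ | ⟨n, h, g, rfl⟩ := eq_base_or_snocMul p
  · simp [mulG_base]
  · simp [mulG_snocMul]

theorem mulG_mul (p : AltWord G H × H) (a b : G) : mulG p (a * b) = mulG (mulG p a) b := by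
  obtain ⟨g, rfl⟩ | ⟨n, h, g, rfl⟩ := eq_base_or_snocMul p
  · simp [mulG_base, mul_assoc]
  · simp [mulG_snocMul, mul_assoc]

/-- The right action of the free product on normal forms. -/
noncomputable def action : Monoid.Coprod G H →* (Function.End (AltWord G H × H))ᵐᵒᵖ :=
  lift
    { toFun := fun g => .op fun p => mulG p g
      map_one' := congrArg MulOpposite.op (funext mulG_one)
      map_mul' := fun a b => congrArg MulOpposite.op (funext fun p => mulG_mul p a b) }
    { toFun := fun h => .op fun p => (p.1, p.2 * h)
      map_one' := congrArg MulOpposite.op (funext fun p => by simp; rfl)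
      map_mul' := fun a b =>
        congrArg MulOpposite.op (funext fun p => by simp [← mul_assoc]; rfl) }

/-- The value of an alternating word in the free product. -/
def eval : AltWord G H → Monoid.Coprod G H
  | base g => inl g
  | snoc n h g => eval n * inr h.1 * inl g.1

/-- The value of a normal form in the free product. -/
def evalPair (p : AltWord G H × H) : Monoid.Coprod G H := eval p.1 * inr p.2

theorem evalPair_snocMul (n : AltWord G H) (h : {h : H // h ≠ 1}) (g : G) :
    evalPair (snocMul n h g) = eval n * inr h.1 * inl g := by
  by_cases hg : g = 1 <;> simp [snocMul, evalPair, hg, eval]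

theorem evalPair_mulG (p : AltWord G H × H) (g : G) :
    evalPair (mulG p g) = evalPair p * inl g := by
  obtain ⟨g, rfl⟩ | ⟨n, h, g, rfl⟩ := eq_base_or_snocMul p
  · simp [mulG_base, evalPair, eval]
  · simp [mulG_snocMul, evalPair_snocMul, mul_assoc]

theorem evalPair_action (z : Monoid.Coprod G H) (p : AltWord G H × H) :
    evalPair ((action z).unop p) = evalPair p * z := by
  induction z using Monoid.Coprod.induction_on generalizing p with
  | inl g => exact evalPair_mulG p g
  | inr h =>
    change evalPair (p.1, p.2 * h) = _
    simp [evalPair, mul_assoc]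
  | mul x y hx hy =>
    rw [map_mul, ← mul_assoc, ← hx, ← hy]
    rfl

theorem action_eval (n : AltWord G H) : (action (eval n)).unop (base 1, 1) = (n, 1) := by
  induction n with
  | base g => exact (mulG_base 1 g).trans (by simp)
  | snoc n h g ih =>
    have : (action (eval (snoc n h g))).unop (base 1, 1) =
      (action (inl g.1)).unop ((action (inr h.1)).unop ((action (eval n)).unop (base 1, 1))) := by
      simp only [eval, map_mul]
      rfl
    rw [this, ih]
    change mulG (n, 1 * h.1) g.1 = _
    simp [mulG, snocMul, h.2, g.2]

theorem action_evalPair (p : AltWord G H × H) :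
    (action (evalPair p)).unop (base 1, 1) = p := by
  have : (action (evalPair p)).unop (base 1, 1) =
      (action (inr p.2)).unop ((action (eval p.1)).unop (base 1, 1)) := by
    simp only [evalPair, map_mul]
    rfl
  rw [this, action_eval]
  change (p.1, 1 * p.2) = p
  simp

/-- Normal forms represent the elements of the free product uniquely. -/
noncomputable def equivCoprod : AltWord G H × H ≃ Monoid.Coprod G H where
  toFun := evalPair
  invFun z := (action z).unop (base 1, 1)
  left_inv := action_evalPair
  right_inv z := by rw [evalPair_action]; simp [evalPair, eval]

/-! ### Words for normal forms -/

variable {Λ Γ : Type} (wG : G → List Λ) (wH : H → List Γ)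

/-- The word of an alternating word: its blocks separated by `none`. -/
def encode : AltWord G H → List (Option (Λ ⊕ Γ))
  | base g => ((wG g).map .inl).map some
  | snoc n h g => encode n ++ none ::
      (((wH h.1).map .inr).map some ++ none :: ((wG g.1).map .inl).map some)

/-- The word of a normal form. -/
noncomputable def encodePair (p : AltWord G H × H) : List (Option (Λ ⊕ Γ)) :=
  appendBlock (fun h => (wH h).map .inr) (encode wG wH p.1) p.2

theorem encodePair_one (n : AltWord G H) : encodePair wG wH (n, 1) = encode wG wH n := by
  simp [encodePair, appendBlock]

theorem encodePair_snocMul (n : AltWord G H) (h : {h : H // h ≠ 1}) (g : G) :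
    encodePair wG wH (snocMul n h g) =
      appendBlock (fun g => (wG g).map .inl) (encodePair wG wH (n, h.1)) g := by
  by_cases hg : g = 1 <;> simp [snocMul, encodePair, appendBlock, hg, encode, h.2]

variable {wG wH}

theorem append_none_cons_inj {B : Type} {u u' : List (Option B)} {s s' : List B} :
    u ++ none :: s.map some = u' ++ none :: s'.map some ↔ u = u' ∧ s = s' := by
  refine ⟨fun h => ?_, by rintro ⟨rfl, rfl⟩; rfl⟩
  have hsome := List.map_injective_iff.2 (Option.some_injective B)
  obtain ⟨t, rfl, ht⟩ | ⟨t, rfl, ht⟩ := List.append_eq_append_iff.1 h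
  · cases t with
    | nil => simpa [hsome.eq_iff] using ht
    | cons a t =>
      obtain ⟨rfl, hs⟩ := List.cons.inj ht
      have : none ∈ s.map some := by rw [hs]; simp
      simp at this
  · cases t with
    | nil => simpa [hsome.eq_iff, eq_comm] using ht
    | cons a t =>
      obtain ⟨rfl, hs⟩ := List.cons.inj ht
      have : none ∈ s'.map some := by rw [hs]; simp
      simp at this

theorem even_countP_encode (n : AltWord G H) : Even ((encode wG wH n).countP Option.isNone) := by
  induction n with
  | base g => simp [encode, List.countP_map, Function.comp_def]
  | snoc n h g ih =>
    simp [encode, List.countP_map, Function.comp_def]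
    exact ih.add (by decide)

theorem not_even_countP_append {n : AltWord G H} {s : List (Λ ⊕ Γ)} :
    ¬ Even ((encode wG wH n ++ none :: s.map some).countP Option.isNone) := by
  have := even_countP_encode (wG := wG) (wH := wH) n
  simpa [List.countP_map, Function.comp_def, List.countP_cons, Nat.even_add_one] using this

theorem encode_injective (hG : Function.Injective wG) (hH : Function.Injective wH) :
    Function.Injective (encode wG wH) := by
  have hl := List.map_injective_iff.2 (Sum.inl_injective (α := Λ) (β := Γ))
  have hr := List.map_injective_iff.2 (Sum.inr_injective (α := Λ) (β := Γ))
  have hsome := List.map_injective_iff.2 (Option.some_injective (Λ ⊕ Γ))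
  have hbase : ∀ g n h g', encode wG wH (base g) ≠ encode wG wH (snoc n h g') := by
    intro g n h g' he
    have : none ∈ encode wG wH (base g) := by rw [he]; simp [encode]
    simp [encode] at this
  intro n
  induction n with
  | base g =>
    rintro (g' | ⟨n', h', g'⟩) he
    · rw [hG (hl (hsome he))]
    · exact (hbase _ _ _ _ he).elim
  | snoc n h g ih =>
    rintro (g' | ⟨n', h', g'⟩) he
    · exact (hbase _ _ _ _ he.symm).elim
    · simp only [encode, ← List.cons_append, ← List.append_assoc] at he
      obtain ⟨he, hg⟩ := append_none_cons_inj.1 he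
      obtain ⟨he, hh⟩ := append_none_cons_inj.1 he
      rw [ih he, Subtype.ext (hG (hl hg)), Subtype.ext (hH (hr hh))]

theorem encodePair_injective (hG : Function.Injective wG) (hH : Function.Injective wH) :
    Function.Injective (encodePair wG wH) := by
  have hr := List.map_injective_iff.2 (Sum.inr_injective (α := Λ) (β := Γ))
  rintro ⟨n, h⟩ ⟨n', h'⟩ he
  by_cases h1 : h = 1 <;> by_cases h1' : h' = 1 <;> simp only [encodePair, appendBlock, h1, h1',
    if_true, if_false] at he
  · rw [encode_injective hG hH he, h1, h1']
  · exact (not_even_countP_append (he ▸ even_countP_encode n)).elim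
  · exact (not_even_countP_append (he ▸ even_countP_encode n')).elim
  · obtain ⟨he, hh⟩ := append_none_cons_inj.1 he
    rw [encode_injective hG hH he, hH (hr hh)]

theorem range_encode_mem_Sclass {m : ℕ} (hG : Function.Injective wG) (hH : Function.Injective wH)
    (hLG : Set.range (fun g => (wG g).map (Sum.inl : Λ → Λ ⊕ Γ)) ∈ Sclass m (Λ ⊕ Γ))
    (hLH : Set.range (fun h => (wH h).map (Sum.inr : Γ → Λ ⊕ Γ)) ∈ Sclass m (Λ ⊕ Γ)) :
    Set.range (encode wG wH) ∈ Sclass m (Option (Λ ⊕ Γ)) := by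
  have hl := List.map_injective_iff.2 (Sum.inl_injective (α := Λ) (β := Γ))
  have hr := List.map_injective_iff.2 (Sum.inr_injective (α := Λ) (β := Γ))
  have hG' := Sclass.map (Sclass.sdiff_singleton hLG ((wG 1).map .inl)) le_rfl some
  have hH' := Sclass.map (Sclass.sdiff_singleton hLH ((wH 1).map .inr)) le_rfl some
  convert Sclass.sepStar (Sclass.map hLG le_rfl some) none (Sclass.sepConcat hH' none hG') using 1
  ext u
  constructor
  · rintro ⟨n, rfl⟩
    induction n with
    | base g => exact .base ⟨_, ⟨g, rfl⟩, rfl⟩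
    | snoc n h g ih =>
      exact .snoc ih ⟨_, ⟨_, ⟨⟨h.1, rfl⟩, fun he => h.2 (hH (hr he))⟩, rfl⟩,
        _, ⟨_, ⟨⟨g.1, rfl⟩, fun he => g.2 (hG (hl he))⟩, rfl⟩, rfl⟩
  · intro hu
    induction hu with
    | base hu =>
      obtain ⟨_, ⟨g, rfl⟩, rfl⟩ := hu
      exact ⟨base g, rfl⟩
    | snoc _ hv ih =>
      obtain ⟨n, rfl⟩ := ih
      obtain ⟨_, ⟨_, ⟨⟨h, rfl⟩, hh⟩, rfl⟩, _, ⟨_, ⟨⟨g, rfl⟩, hg⟩, rfl⟩, rfl⟩ := hv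
      exact ⟨snoc n ⟨h, fun e => hh (e ▸ rfl)⟩ ⟨g, fun e => hg (e ▸ rfl)⟩, rfl⟩

end AltWord
/-- **Free product.** If `(G,X,Λ)` is `S_k`-graph automatic and `(H,Y,Γ)`
is `S_l`-graph automatic (with `Λ`, `Γ` disjoint finite alphabets), then the free product
`G ∗ H` is `S_{max(k,l)}`-graph automatic with respect to the generating set `X ∪ Y` and
the alphabet `{#} ∪ Λ ∪ Γ` (modelled as `Option (Λ ⊕ Γ)`, with `none` the new symbol `#`). -/
theorem free_product_graph_automatic {k l : ℕ}
    {G H : Type} [Group G] [Group H] (X : Set G) (Y : Set H)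
    (hsymX : ∀ x ∈ X, x⁻¹ ∈ X) (hgenX : Subgroup.closure X = ⊤)
    (hsymY : ∀ y ∈ Y, y⁻¹ ∈ Y) (hgenY : Subgroup.closure Y = ⊤)
    {Λ Γ : Type} [Fintype Λ] [Fintype Γ]
    (hG : SGraphAutomatic k X Λ) (hH : SGraphAutomatic l Y Γ) :
    SGraphAutomatic (max k l)
      (⇑(Monoid.Coprod.inl : G →* Monoid.Coprod G H) '' X ∪
        ⇑(Monoid.Coprod.inr : H →* Monoid.Coprod G H) '' Y)
      (Option (Λ ⊕ Γ)) := by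
  obtain ⟨wG, hwG, hLG, hMG⟩ := sGraphAutomatic_iff.1 hG
  obtain ⟨wH, hwH, hLH, hMH⟩ := sGraphAutomatic_iff.1 hH
  have hwG' : Function.Injective fun g => (wG g).map (Sum.inl : Λ → Λ ⊕ Γ) :=
    (List.map_injective_iff.2 Sum.inl_injective).comp hwG
  have hwH' : Function.Injective fun h => (wH h).map (Sum.inr : Γ → Λ ⊕ Γ) :=
    (List.map_injective_iff.2 Sum.inr_injective).comp hwH
  replace hLG : Set.range (fun g => (wG g).map (Sum.inl : Λ → Λ ⊕ Γ)) ∈ Sclass (max k l) _ := by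
    convert Sclass.map hLG (le_max_left k l) (Sum.inl : Λ → Λ ⊕ Γ) using 1
    exact Set.range_comp _ _
  replace hLH : Set.range (fun h => (wH h).map (Sum.inr : Γ → Λ ⊕ Γ)) ∈ Sclass (max k l) _ := by
    convert Sclass.map hLH (le_max_right k l) (Sum.inr : Γ → Λ ⊕ Γ) using 1
    exact Set.range_comp _ _
  replace hMG : ∀ x ∈ X, Set.range (fun g => conv ((wG g).map (Sum.inl : Λ → Λ ⊕ Γ))
      ((wG (g * x)).map (Sum.inl : Λ → Λ ⊕ Γ))) ∈ Sclass (max k l) _ := by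
    intro x hx
    convert Sclass.map (hMG x hx) (le_max_left k l)
      (Prod.map (Option.map (Sum.inl : Λ → Λ ⊕ Γ)) (Option.map (Sum.inl : Λ → Λ ⊕ Γ))) using 1
    simp only [conv_map_map]
    exact Set.range_comp _ _
  replace hMH : ∀ y ∈ Y, Set.range (fun h => conv ((wH h).map (Sum.inr : Γ → Λ ⊕ Γ))
      ((wH (h * y)).map (Sum.inr : Γ → Λ ⊕ Γ))) ∈ Sclass (max k l) _ := by
    intro y hy
    convert Sclass.map (hMH y hy) (le_max_right k l)
      (Prod.map (Option.map (Sum.inr : Γ → Λ ⊕ Γ)) (Option.map (Sum.inr : Γ → Λ ⊕ Γ))) using 1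
    simp only [conv_map_map]
    exact Set.range_comp _ _
  have hP := AltWord.range_encode_mem_Sclass hwG hwH hLG hLH
  have hQ : {p | ∃ n, ∃ h : {h : H // h ≠ 1}, p = AltWord.encodePair wG wH (n, h.1)} ∈
      Sclass (max k l) (Option (Λ ⊕ Γ)) := by
    convert Sclass.sepConcat hP none
      (Sclass.map (Sclass.sdiff_singleton hLH ((wH 1).map .inr)) le_rfl some) using 1
    ext p
    constructor
    · rintro ⟨n, h, rfl⟩
      exact ⟨_, ⟨n, rfl⟩, _, ⟨_, ⟨⟨h.1, rfl⟩, hwH'.ne h.2⟩, rfl⟩,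
        by simp [AltWord.encodePair, appendBlock, h.2]⟩
    · rintro ⟨_, ⟨n, rfl⟩, _, ⟨_, ⟨⟨h, rfl⟩, hh⟩, rfl⟩, rfl⟩
      have hh : h ≠ 1 := fun e => hh (e ▸ rfl)
      exact ⟨n, ⟨h, hh⟩, by simp [AltWord.encodePair, appendBlock, hh]⟩
  refine sGraphAutomatic_iff.2 ⟨fun z => AltWord.encodePair wG wH (AltWord.equivCoprod.symm z),
    (AltWord.encodePair_injective hwG hwH).comp (Equiv.injective _), ?_, ?_⟩
  · convert Sclass.union hP hQ using 1
    ext u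
    constructor
    · rintro ⟨z, rfl⟩
      obtain ⟨⟨n, h⟩, rfl⟩ := AltWord.equivCoprod.surjective z
      simp only [Equiv.symm_apply_apply]
      by_cases hh : h = 1
      · subst hh
        exact Or.inl ⟨n, (AltWord.encodePair_one wG wH n).symm⟩
      · exact Or.inr ⟨n, ⟨h, hh⟩, rfl⟩
    · rintro (⟨n, rfl⟩ | ⟨n, h, rfl⟩)
      · exact ⟨AltWord.equivCoprod (n, 1), by simp [AltWord.encodePair_one]⟩
      · exact ⟨AltWord.equivCoprod (n, h.1), by simp⟩
  · have hmul : ∀ (x : Monoid.Coprod G H) (f : AltWord G H × H → AltWord G H × H),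
        (∀ p, AltWord.evalPair (f p) = AltWord.evalPair p * x) →
        Set.range (fun z => conv (AltWord.encodePair wG wH (AltWord.equivCoprod.symm z))
          (AltWord.encodePair wG wH (AltWord.equivCoprod.symm (z * x)))) =
        Set.range (fun p => conv (AltWord.encodePair wG wH p) (AltWord.encodePair wG wH (f p))) := by
      intro x f hf
      rw [← AltWord.equivCoprod.surjective.range_comp]
      congr 1
      funext p
      have : AltWord.equivCoprod.symm (AltWord.equivCoprod p * x) = f p :=
        (Equiv.symm_apply_eq _).2 (hf p).symm
      simp [this]
    rintro _ (⟨x, hx, rfl⟩ | ⟨y, hy, rfl⟩)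
    · rw [hmul _ _ fun p => AltWord.evalPair_mulG p x]
      convert Sclass.union (Sclass.map (hMG x hx) le_rfl
        (Prod.map (Option.map some) (Option.map some)))
        (Sclass.range_conv_appendBlock hwG' hQ hLG (hMG x hx)) using 1
      ext c
      constructor
      · rintro ⟨p, rfl⟩
        obtain ⟨g, rfl⟩ | ⟨n, h, g, rfl⟩ := AltWord.eq_base_or_snocMul p
        · refine Or.inl ⟨_, ⟨g, rfl⟩, ?_⟩
          simp only [AltWord.mulG_base, AltWord.encodePair_one, AltWord.encode, conv_map_map]
        · refine Or.inr ⟨_, ⟨n, h, rfl⟩, g, ?_⟩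
          simp only [AltWord.mulG_snocMul, AltWord.encodePair_snocMul]
      · rintro (⟨_, ⟨g, rfl⟩, rfl⟩ | ⟨_, ⟨n, h, rfl⟩, g, rfl⟩)
        · refine ⟨(.base g, 1), ?_⟩
          simp only [AltWord.mulG_base, AltWord.encodePair_one, AltWord.encode, conv_map_map]
        · refine ⟨AltWord.snocMul n h g, ?_⟩
          simp only [AltWord.mulG_snocMul, AltWord.encodePair_snocMul]
    · rw [hmul _ (fun p => (p.1, p.2 * y)) fun p => by simp [AltWord.evalPair, mul_assoc]]
      convert Sclass.range_conv_appendBlock hwH' hP hLH (hMH y hy) using 1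
      ext c
      constructor
      · rintro ⟨⟨n, h⟩, rfl⟩
        exact ⟨_, ⟨n, rfl⟩, h, rfl⟩
      · rintro ⟨_, ⟨n, rfl⟩, h, rfl⟩
        exact ⟨(n, h), rfl⟩
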